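/- Let n ≥ 1, s ∈ (0,1), m > n/2, and define η(x) = (1+|x|²)^{-m/2} for x ∈ ℝⁿ and ρ(x) = ∫_{ℝⁿ} (η(x)-η(y))²/|x-y|^{n+2s} dy. Then there exists a constant C = C(n,s,m) > 0 such that C⁻¹(1+|x|²)^{-n/2-s} ≤ ρ(x) ≤ C(1+|x|²)^{-n/2-s} for all x ∈ ℝⁿ. -/

import Mathlib

open MeasureTheory

lemma lip_aux (m : ℝ) (hm : 0 < m) : ∃ L : ℝ, 0 ≤ L ∧ ∀ t ∈ Set.Icc (1/2:ℝ) (3/2),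
    |1 - t ^ (-m)| ≤ L * |1 - t| := by
  refine ⟨m * (1/2:ℝ) ^ (-m-1), by positivity, fun t ht => ?_⟩
  have := Convex.norm_image_sub_le_of_norm_deriv_le (𝕜 := ℝ) (f := fun t : ℝ => t ^ (-m))
    (C := m * (1/2:ℝ) ^ (-m-1)) (s := Set.Icc (1/2:ℝ) (3/2)) (x := t) (y := 1) ?_ ?_
    (convex_Icc _ _) ht (by constructor <;> norm_num)
  · simpa using this
  · intro u hu
    exact (Real.differentiableAt_rpow_const_of_ne _ (by linarith [hu.1]))
  · intro u hu
    have hu0 : 0 < u := by linarith [hu.1]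
    rw [Real.deriv_rpow_const, norm_mul, norm_neg, Real.norm_of_nonneg hm.le,
      Real.norm_of_nonneg (Real.rpow_nonneg hu0.le _)]
    exact mul_le_mul_of_nonneg_left (Real.rpow_le_rpow_of_nonpos (by norm_num) hu.1
      (by linarith : -m - 1 ≤ 0)) hm.le

noncomputable def gker (p t : ℝ) : ℝ := min (t ^ 2) 1 / t ^ p

lemma gker_nonneg (p t : ℝ) (ht : 0 ≤ t) : 0 ≤ gker p t := by
  unfold gker
  have := Real.rpow_nonneg ht p
  positivity

lemma gker_integrable (n : ℕ) (hn : 1 ≤ n) (s : ℝ) (hs : 0 < s) (hs1 : s < 1) :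
    Integrable (fun w : EuclideanSpace ℝ (Fin n) => gker (n + 2 * s) ‖w‖) := by
  have : Nonempty (Fin n) := ⟨⟨0, hn⟩⟩
  have : Nontrivial (EuclideanSpace ℝ (Fin n)) := inferInstance
  rw [integrable_fun_norm_addHaar volume (f := gker (n + 2 * s)), finrank_euclideanSpace, Fintype.card_fin]
  have hpow : ∀ t : ℝ, 0 < t → t ^ (n-1) / t ^ ((n:ℝ)+2*s) = t ^ (-1-2*s) := by
    intro t ht
    rw [← Real.rpow_natCast, ← Real.rpow_sub ht, Nat.cast_sub hn]
    congr 1; push_cast; ring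
  have hmeas : ∀ S : Set ℝ, AEStronglyMeasurable (fun y : ℝ => y ^ (n - 1) • gker (n + 2 * s) y) (volume.restrict S) := by
    intro S
    apply Measurable.aestronglyMeasurable
    unfold gker
    simp only [smul_eq_mul]
    fun_prop
  rw [← Set.Ioc_union_Ioi_eq_Ioi zero_le_one]
  refine IntegrableOn.union ?_ ?_
  · have h1 : IntegrableOn (fun t : ℝ => t ^ (1 - 2 * s)) (Set.Ioc 0 1) := by
      rw [← intervalIntegrable_iff_integrableOn_Ioc_of_le zero_le_one]
      exact intervalIntegral.intervalIntegrable_rpow' (by linarith)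
    refine Integrable.mono' h1 (hmeas _) ?_
    filter_upwards [ae_restrict_mem measurableSet_Ioc] with t ht
    have ht0 := ht.1
    rw [Real.norm_of_nonneg (by have := gker_nonneg (n+2*s) t ht0.le; positivity), smul_eq_mul, gker]
    calc t ^ (n-1) * (min (t^2) 1 / t ^ ((n:ℝ)+2*s)) ≤ t ^ (n-1) * (t^2 / t ^ ((n:ℝ)+2*s)) := by
          gcongr; exact min_le_left _ _
      _ = t ^ (n-1) / t ^ ((n:ℝ)+2*s) * t ^ (2:ℝ) := by rw [Real.rpow_two]; ring
      _ = t ^ (1-2*s) := by rw [hpow t ht0, ← Real.rpow_add ht0]; congr 1; ring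
      _ ≤ _ := le_rfl
  · have h1 : IntegrableOn (fun t : ℝ => t ^ (-1 - 2 * s)) (Set.Ioi 1) :=
      integrableOn_Ioi_rpow_of_lt (by linarith) one_pos
    refine Integrable.mono' h1 (hmeas _) ?_
    filter_upwards [ae_restrict_mem measurableSet_Ioi] with t ht
    have ht0 : 0 < t := lt_trans one_pos ht
    rw [Real.norm_of_nonneg (by have := gker_nonneg (n+2*s) t ht0.le; positivity), smul_eq_mul, gker]
    calc t ^ (n-1) * (min (t^2) 1 / t ^ ((n:ℝ)+2*s)) ≤ t ^ (n-1) * (1 / t ^ ((n:ℝ)+2*s)) := by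
          gcongr; exact min_le_right _ _
      _ = t ^ (n-1) / t ^ ((n:ℝ)+2*s) := by ring
      _ = _ := hpow t ht0

lemma ptwise (m p L : ℝ) (hp : 0 < p) (hL : 0 ≤ L)
    (hLip : ∀ t ∈ Set.Icc (1/2:ℝ) (3/2), |1 - t ^ (-m)| ≤ L * |1 - t|)
    (a b z : ℝ) (ha : 1 ≤ a) (hb : 1 ≤ b) (hz : 0 ≤ z) (hab : |a - b| ≤ z) :
    (a ^ (-m) - b ^ (-m)) ^ 2 / z ^ p ≤
      (L ^ 2 + 4) * ((a ^ (-m)) ^ 2 * (a ^ (-p) * gker p (a⁻¹ * z)))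
        + 2 ^ p * (a ^ (-p) * (b ^ (-m)) ^ 2) := by
  have ha0 : 0 < a := by linarith
  have hb0 : 0 < b := by linarith
  have hg := gker_nonneg p (a⁻¹ * z) (by positivity)
  rcases hz.eq_or_lt with rfl | hz
  · rw [Real.zero_rpow hp.ne', div_zero]; positivity
  have hzp : 0 < z ^ p := by positivity
  have hgz : a ^ (-p) * gker p (a⁻¹ * z) = min ((a⁻¹ * z) ^ 2) 1 / z ^ p := by
    unfold gker
    rw [Real.mul_rpow (by positivity) hz.le, Real.inv_rpow ha0.le, Real.rpow_neg ha0.le]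
    have : 0 < a ^ p := by positivity
    field_simp
  rw [hgz]
  have hA : 0 < a ^ (-m) := by positivity
  have hB : 0 < b ^ (-m) := by positivity
  rcases le_or_gt (a / 2) z with h | h
  · have hmin : 1/4 ≤ min ((a⁻¹ * z) ^ 2) 1 := by
      have : 1/2 ≤ a⁻¹ * z := by
        rw [inv_mul_eq_div, le_div_iff₀ ha0]; linarith
      refine le_min (by nlinarith) (by norm_num)
    have h1 : (1:ℝ) / z ^ p ≤ 2 ^ p * a ^ (-p) := by
      rw [Real.rpow_neg ha0.le, ← div_eq_mul_inv, ← Real.div_rpow (by norm_num) ha0.le,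
        div_le_iff₀ hzp, ← Real.mul_rpow (by positivity) hz.le]
      apply Real.one_le_rpow _ hp.le
      rw [div_mul_eq_mul_div, le_div_iff₀ ha0]; linarith
    calc (a ^ (-m) - b ^ (-m)) ^ 2 / z ^ p
        ≤ ((a ^ (-m)) ^ 2 + (b ^ (-m)) ^ 2) / z ^ p := by
          gcongr; nlinarith [mul_pos hA hB]
      _ = (a ^ (-m)) ^ 2 * 1 / z ^ p + (1 / z ^ p) * (b ^ (-m)) ^ 2 := by ring
      _ ≤ (a ^ (-m)) ^ 2 * ((L ^ 2 + 4) * min ((a⁻¹ * z) ^ 2) 1) / z ^ p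
          + (2 ^ p * a ^ (-p)) * (b ^ (-m)) ^ 2 := by
          gcongr
          nlinarith [sq_nonneg L, mul_nonneg (sq_nonneg L) (by linarith : 0 ≤ min ((a⁻¹ * z) ^ 2) 1)]
      _ = _ := by ring
  · have hza : a⁻¹ * z ≤ 1 := by
      rw [inv_mul_eq_div, div_le_iff₀ ha0]; linarith
    rw [min_eq_left (by have : 0 ≤ a⁻¹ * z := by positivity
                        nlinarith)]
    obtain ⟨h1, h2⟩ := abs_le.1 hab
    have := hLip (b / a) ⟨by rw [le_div_iff₀ ha0]; linarith, by rw [div_le_iff₀ ha0]; linarith⟩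
    have e1 : 1 - b / a = a⁻¹ * (a - b) := by field_simp
    have h3 : |1 - (b/a) ^ (-m)| ≤ L * (a⁻¹ * z) := by
      refine this.trans ?_
      rw [e1, abs_mul, abs_of_pos (inv_pos.2 ha0)]
      gcongr
    have h4 : a ^ (-m) - b ^ (-m) = a ^ (-m) * (1 - (b/a) ^ (-m)) := by
      rw [Real.div_rpow hb0.le ha0.le]; field_simp
    have h5 : (1 - (b/a) ^ (-m)) ^ 2 ≤ L^2 * (a⁻¹ * z) ^ 2 := by
      rw [← mul_pow, ← sq_abs]
      gcongr
    rw [h4, mul_pow]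
    calc _ ≤ (a ^ (-m)) ^ 2 * (L^2 * (a⁻¹ * z) ^ 2) / z ^ p := by gcongr
      _ ≤ (a ^ (-m)) ^ 2 * ((L^2+4) * (a⁻¹ * z) ^ 2) / z ^ p + 0 := by
        rw [add_zero]; gcongr; linarith
      _ = (L ^ 2 + 4) * ((a ^ (-m)) ^ 2 * ((a⁻¹ * z) ^ 2 / z ^ p)) + 0 := by ring
      _ ≤ _ := by gcongr; positivity

lemma sqrt_lip {E : Type*} [NormedAddCommGroup E] (x y : E) :
    |√(1 + ‖x‖^2) - √(1 + ‖y‖^2)| ≤ ‖x - y‖ := by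
  refine le_trans ?_ (abs_norm_sub_norm_le x y)
  have hx := Real.sq_sqrt (by positivity : 0 ≤ 1 + ‖x‖^2)
  have hy := Real.sq_sqrt (by positivity : 0 ≤ 1 + ‖y‖^2)
  set a := √(1 + ‖x‖^2)
  set b := √(1 + ‖y‖^2)
  have ha : 0 ≤ a := Real.sqrt_nonneg _
  have hb : 0 ≤ b := Real.sqrt_nonneg _
  apply abs_le_of_sq_le_sq' _ (abs_nonneg _) |> abs_le.2
  rw [sq_abs]
  have : 1 + ‖x‖ * ‖y‖ ≤ a * b := by
    apply le_of_sq_le_sq _ (by positivity)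
    rw [mul_pow, hx, hy]; nlinarith [sq_nonneg (‖x‖ - ‖y‖)]
  nlinarith

theorem kernel_two_sided_estimate (n : ℕ) (s m : ℝ)
    (hn : 1 ≤ n) (hs : 0 < s) (hs1 : s < 1) (hm : m > n / 2)
    (η ρ : EuclideanSpace ℝ (Fin n) → ℝ)
    (hη : ∀ x, η x = (1 + ‖x‖ ^ 2) ^ (-m / 2))
    (hρ : ∀ x, ρ x = ∫ y, (η x - η y) ^ 2 / ‖x - y‖ ^ ((n : ℝ) + 2 * s)) :
    ∃ C > (0 : ℝ), ∀ x,
      C⁻¹ * (1 + ‖x‖ ^ 2) ^ (-(n : ℝ) / 2 - s) ≤ ρ x ∧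
      ρ x ≤ C * (1 + ‖x‖ ^ 2) ^ (-(n : ℝ) / 2 - s) := by
  have hn1 : (1:ℝ) ≤ n := by exact_mod_cast hn
  have hm0 : 0 < m := by linarith
  obtain ⟨L, hL, hLip⟩ := lip_aux m hm0
  have hgi := gker_integrable n hn s hs hs1
  set p : ℝ := (n:ℝ) + 2 * s with hp
  have hp0 : 0 < p := by positivity
  let a : EuclideanSpace ℝ (Fin n) → ℝ := fun x => √(1 + ‖x‖ ^ 2)
  have ha1 : ∀ x, 1 ≤ a x := fun x => by
    apply Real.one_le_sqrt.2; nlinarith [sq_nonneg ‖x‖]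
  have hpw : ∀ (x : EuclideanSpace ℝ (Fin n)) (r : ℝ), (1 + ‖x‖ ^ 2) ^ r = a x ^ (2 * r) := by
    intro x r
    simp only [a]
    rw [Real.sqrt_eq_rpow, ← Real.rpow_mul (by positivity)]
    congr 1; ring
  have hηa : ∀ x, η x = a x ^ (-m) := by
    intro x; rw [hη, hpw]; congr 1; ring
  have hηc : Continuous η := by
    have : η = fun x => (1 + ‖x‖ ^ 2) ^ (-m / 2) := funext hη
    rw [this]
    refine Continuous.rpow_const (by fun_prop) (fun x => Or.inl (by positivity))
  have hηi : Integrable (fun y => η y ^ 2) := by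
    have h := integrable_rpow_neg_one_add_norm_sq (E := EuclideanSpace ℝ (Fin n)) (μ := volume)
      (r := 2 * m) (by rw [finrank_euclideanSpace, Fintype.card_fin]; linarith)
    refine h.congr (Filter.Eventually.of_forall fun y => ?_)
    simp only
    rw [hη, ← Real.rpow_mul_natCast (by positivity)]
    congr 1; push_cast; ring
  set K := ∫ w : EuclideanSpace ℝ (Fin n), gker p ‖w‖ with hK
  set I := ∫ y, η y ^ 2 with hI
  have hK0 : 0 ≤ K := integral_nonneg fun w => gker_nonneg _ _ (norm_nonneg _)
  have hI0 : 0 ≤ I := integral_nonneg fun w => sq_nonneg _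
  -- dominating function
  let D : EuclideanSpace ℝ (Fin n) → EuclideanSpace ℝ (Fin n) → ℝ := fun x y =>
    (L ^ 2 + 4) * (η x ^ 2 * (a x ^ (-p) * gker p ‖(a x)⁻¹ • (x - y)‖))
        + 2 ^ p * (a x ^ (-p) * η y ^ 2)
  have hdom : ∀ x y, (η x - η y) ^ 2 / ‖x - y‖ ^ p ≤ D x y := by
    intro x y
    have := ptwise m p L hp0 hL hLip (a x) (a y) ‖x - y‖ (ha1 x) (ha1 y) (norm_nonneg _)
      (sqrt_lip x y)
    simp only [D]
    rw [norm_smul, norm_inv, Real.norm_of_nonneg (by linarith [ha1 x] : 0 ≤ a x), hηa, hηa]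
    exact this
  have hgx : ∀ x, Integrable (fun y => gker p ‖(a x)⁻¹ • (x - y)‖) := by
    intro x
    have h1 := hgi.comp_smul (R := (a x)⁻¹) (inv_ne_zero (by linarith [ha1 x]))
    exact h1.comp_sub_left x
  have hD1 : ∀ x, Integrable (fun y => (L ^ 2 + 4) * (η x ^ 2 * (a x ^ (-p) * gker p ‖(a x)⁻¹ • (x - y)‖))) :=
    fun x => (((hgx x).const_mul _).const_mul _).const_mul _
  have hD2 : ∀ x, Integrable (fun y => 2 ^ p * (a x ^ (-p) * η y ^ 2)) :=
    fun x => (hηi.const_mul _).const_mul _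
  have hDi : ∀ x, Integrable (D x) := fun x => (hD1 x).add (hD2 x)
  have hfn : ∀ x y, 0 ≤ (η x - η y) ^ 2 / ‖x - y‖ ^ p := fun x y => by positivity
  have hfi : ∀ x, Integrable (fun y => (η x - η y) ^ 2 / ‖x - y‖ ^ p) := by
    intro x
    refine (hDi x).mono' ?_ (Filter.Eventually.of_forall fun y => ?_)
    · have := hηc.measurable
      exact Measurable.aestronglyMeasurable (by fun_prop)
    · rw [Real.norm_of_nonneg (hfn x y)]; exact hdom x y
  have hDint : ∀ x, ∫ y, D x y ≤ ((L ^ 2 + 4) * K + 2 ^ p * I) * a x ^ (-p) := by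
    intro x
    have ha0 : 0 < a x := by linarith [ha1 x]
    have e1 : ∫ y, gker p ‖(a x)⁻¹ • (x - y)‖ = a x ^ n * K := by
      rw [integral_sub_left_eq_self (fun z => gker p ‖(a x)⁻¹ • z‖),
        Measure.integral_comp_inv_smul volume (fun z => gker p ‖z‖), finrank_euclideanSpace,
        Fintype.card_fin, abs_of_pos (by positivity), smul_eq_mul]
    have e2 : ∫ y, D x y = (L ^ 2 + 4) * (η x ^ 2 * (a x ^ (-p) * (a x ^ n * K)))
        + 2 ^ p * (a x ^ (-p) * I) := by
      simp only [D]
      rw [integral_add (hD1 x) (hD2 x)]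
      simp only [integral_const_mul]
      rw [e1]
    have e3 : η x ^ 2 * a x ^ n ≤ 1 := by
      rw [hηa, ← Real.rpow_natCast, ← Real.rpow_natCast, ← Real.rpow_mul ha0.le,
        ← Real.rpow_add ha0]
      apply Real.rpow_le_one_of_one_le_of_nonpos (ha1 x)
      push_cast; linarith
    rw [e2]
    calc _ = (L ^ 2 + 4) * K * a x ^ (-p) * (η x ^ 2 * a x ^ n) + 2 ^ p * I * a x ^ (-p) := by ring
      _ ≤ (L ^ 2 + 4) * K * a x ^ (-p) * 1 + 2 ^ p * I * a x ^ (-p) := by gcongr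
      _ = _ := by ring
  -- lower bound
  obtain ⟨q, hq⟩ : ∃ q : EuclideanSpace ℝ (Fin n), ‖q‖ = 4 := by
    have : Nonempty (Fin n) := ⟨⟨0, hn⟩⟩
    exact ⟨EuclideanSpace.single ⟨0, hn⟩ 4, by simp⟩
  let v := volume.real (Metric.closedBall (0 : EuclideanSpace ℝ (Fin n)) 1)
  have hv : 0 < v := ENNReal.toReal_pos (Metric.measure_closedBall_pos _ _ one_pos).ne'
    measure_closedBall_lt_top.ne
  have hmono : ∀ u w : ℝ, 0 < u → u ≤ w → w ^ (-m/2) ≤ u ^ (-m/2) := fun u w hu huw =>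
    Real.rpow_le_rpow_of_nonpos hu huw (by linarith)
  have hsm : ∀ u w : ℝ, 0 < u → u < w → w ^ (-m/2) < u ^ (-m/2) := fun u w hu huw =>
    Real.rpow_lt_rpow_of_neg hu huw (by linarith)
  let δ : ℝ := min ((2:ℝ) ^ (-m/2) - 5 ^ (-m/2)) (5 ^ (-m/2) - 10 ^ (-m/2))
  have hδ : 0 < δ := lt_min (sub_pos.2 (hsm 2 5 (by norm_num) (by norm_num)))
    (sub_pos.2 (hsm 5 10 (by norm_num) (by norm_num)))
  have hna : ∀ x, ‖x‖ ≤ a x := fun x => Real.le_sqrt_of_sq_le (by linarith)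
  have hcen : ∀ x, ∃ c : EuclideanSpace ℝ (Fin n), ∀ y ∈ Metric.closedBall c 1,
      δ ≤ |η x - η y| ∧ ‖x - y‖ ≤ 7 * a x := by
    intro x
    rcases le_or_gt 2 ‖x‖ with hx | hx
    · refine ⟨0, fun y hy => ?_⟩
      have hy1 : ‖y‖ ≤ 1 := by simpa using hy
      refine ⟨?_, ?_⟩
      · rw [abs_sub_comm, hη, hη]
        refine le_trans ((min_le_left _ _).trans ?_) (le_abs_self _)
        have h1 := hmono (1 + ‖y‖^2) 2 (by positivity) (by nlinarith [norm_nonneg y])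
        have h2 := hmono 5 (1 + ‖x‖^2) (by positivity) (by nlinarith)
        linarith
      · have := norm_sub_le x y
        linarith [hna x, ha1 x]
    · refine ⟨q, fun y hy => ?_⟩
      have hy1 : ‖y - q‖ ≤ 1 := by simpa [dist_eq_norm] using hy
      have hyu : ‖y‖ ≤ 5 := by
        have := norm_sub_norm_le y q; linarith
      have hyl : 3 ≤ ‖y‖ := by
        have := norm_sub_norm_le q y; rw [norm_sub_rev] at this; linarith
      refine ⟨?_, ?_⟩
      · rw [hη, hη]
        refine le_trans ((min_le_right _ _).trans ?_) (le_abs_self _)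
        have h1 := hmono (1 + ‖x‖^2) 5 (by positivity) (by nlinarith [norm_nonneg x])
        have h2 := hmono 10 (1 + ‖y‖^2) (by positivity) (by nlinarith)
        linarith
      · have := norm_sub_le x y
        linarith [ha1 x]
  have hlow : ∀ x, δ ^ 2 * 7 ^ (-p) * v * a x ^ (-p) ≤ ρ x := by
    intro x
    obtain ⟨c, hc⟩ := hcen x
    have ha0 : 0 < a x := by linarith [ha1 x]
    have hvc : volume.real (Metric.closedBall c 1) = v := by
      simp only [v, Measure.real]
      rw [Measure.addHaar_closedBall_center]
    have h1 := setIntegral_ge_of_const_le_real (μ := volume) (s := Metric.closedBall c 1)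
      (f := fun y => (η x - η y) ^ 2 / ‖x - y‖ ^ p) (c := δ ^ 2 * (7 * a x) ^ (-p))
      measurableSet_closedBall measure_closedBall_lt_top.ne ?_ (hfi x).integrableOn
    · rw [hρ]
      refine le_trans ?_ (setIntegral_le_integral (s := Metric.closedBall c 1) (hfi x) (Filter.Eventually.of_forall (hfn x)))
      refine le_trans (le_of_eq ?_) h1
      rw [hvc, Real.mul_rpow (by norm_num) ha0.le]; ring
    · intro y hy
      obtain ⟨h2, h3⟩ := hc y hy
      have hxy : 0 < ‖x - y‖ := by
        rw [norm_pos_iff, sub_ne_zero]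
        rintro rfl
        simp at h2; linarith
      rw [Real.rpow_neg (by positivity), ← div_eq_mul_inv, ← sq_abs (η x - η y)]
      gcongr
  have hexp : ∀ x, (1 + ‖x‖ ^ 2) ^ (-(n : ℝ) / 2 - s) = a x ^ (-p) := by
    intro x; rw [hpw]; congr 1; rw [hp]; ring
  set cl := δ ^ 2 * 7 ^ (-p) * v with hcl
  have hcl0 : 0 < cl := by positivity
  set Cu := (L ^ 2 + 4) * K + 2 ^ p * I with hCu
  have hCu0 : 0 ≤ Cu := by positivity
  have hcli : 0 < cl⁻¹ := inv_pos.2 hcl0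
  refine ⟨Cu + cl⁻¹, by positivity, fun x => ?_⟩
  have hap : 0 < a x ^ (-p) := Real.rpow_pos_of_pos (by linarith [ha1 x]) _
  rw [hexp]
  constructor
  · refine le_trans ?_ (hlow x)
    gcongr
    exact inv_le_of_inv_le₀ hcl0 (by linarith)
  · rw [hρ]
    refine (integral_mono (hfi x) (hDi x) (hdom x)).trans ((hDint x).trans ?_)
    gcongr
    linarith
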